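/- Let X be a nonempty set and let Φ be a mapping with domain X². Then the following three conditions are equivalent: (i) Φ is combinatorially similar to an ultrametric; (ii) there is b₀ ∈ Φ(X²) such that Φ⁻¹(b₀) = Δ_X, the binary relation ≼_Φ := u_Φᵗ ∪ Δ_{Φ(X²)} is a partial order on Φ(X²), b₀ is the smallest element of (Φ(X²),≼_Φ), Φ is a ≼_Φ-ultrametric on X, and there is a linear order ≼ on Φ(X²) such that ≼_Φ ⊆ ≼ and (Φ(X²),≼) is order-isomorphic to a subposet of (ℝ⁺,≤); (iii) Φ is symmetric, Φ⁻¹(a₀) = Δ_X holds for some a₀ ∈ Φ(X²), for every triple ⟨x₁,x₂,x₃⟩ of points of X there is a permutation ⟨x_{i₁},x_{i₂},x_{i₃}⟩ of it such that Φ(x_{i₁},x_{i₂}) = Φ(x_{i₂},x_{i₃}), and there is a linear order ≼ on Φ(X²) such that a₀ is the smallest element of (Φ(X²),≼), u_Φ ⊆ ≼ holds, and (Φ(X²),≼) is order-isomorphic to a subposet of (ℝ⁺,≤). -/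

import Mathlib

namespace CombSimPaper

/-- The range `Φ(X²)` of a mapping `Φ` with domain `X²`. -/
def rng {X A : Type*} (Φ : X → X → A) : Set A := {a | ∃ x y, Φ x y = a}

/-- `Φ` is strongly consistent with the binary relation `R` on `X`. -/
def StronglyConsistent {X A : Type*} (Φ : X → X → A) (R : X → X → Prop) : Prop :=
  ∀ x₁ x₂ x₃ x₄, R x₁ x₂ → R x₃ x₄ → Φ x₁ x₃ = Φ x₂ x₄

/-- The fiber `Φ⁻¹(a)`, viewed as a binary relation on `X`. -/
def fiber {X A : Type*} (Φ : X → X → A) (a : A) : X → X → Prop :=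
  fun x y => Φ x y = a

/-- `Φ` is `a₀`-coherent: the fiber `Φ⁻¹(a₀)` is an equivalence relation and `Φ` is
strongly consistent with it. -/
def Coherent {X A : Type*} (Φ : X → X → A) (a₀ : A) : Prop :=
  Equivalence (fiber Φ a₀) ∧ StronglyConsistent Φ (fiber Φ a₀)

/-- `g : Y → X` is a combinatorial similarity for the mappings `Ψ` (with domain `Y²`)
and `Φ` (with domain `X²`). -/
def CombSimWith {X Y A B : Type*} (Φ : X → X → A) (Ψ : Y → Y → B) (g : Y → X) : Prop :=
  Function.Bijective g ∧ ∃ f : A → B, Set.BijOn f (rng Φ) (rng Ψ) ∧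
    ∀ x y : Y, Ψ x y = f (Φ (g x) (g y))

/-- `Φ` is combinatorially similar to `Ψ`. -/
def CombSim {X Y A B : Type*} (Φ : X → X → A) (Ψ : Y → Y → B) : Prop :=
  ∃ g : Y → X, CombSimWith Φ Ψ g

/-- Some permutation `⟨x_{i₁}, x_{i₂}, x_{i₃}⟩` of the triple `⟨x₁, x₂, x₃⟩`
satisfies the ternary predicate `P`. -/
def PermTriple {X : Type*} (P : X → X → X → Prop) (x₁ x₂ x₃ : X) : Prop :=
  ∃ σ : Equiv.Perm (Fin 3),
    P (![x₁, x₂, x₃] (σ 0)) (![x₁, x₂, x₃] (σ 1)) (![x₁, x₂, x₃] (σ 2))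

/-- `d : X² → Q` is a `≼`-pseudoultrametric (for the order `le` with smallest element `q₀`). -/
def QPseudoUltra {X Q : Type*} (le : Q → Q → Prop) (q₀ : Q) (d : X → X → Q) : Prop :=
  (∀ x y, d x y = d y x) ∧ (∀ x, d x x = q₀) ∧
  ∀ x₁ x₂ x₃, PermTriple (fun a b c => le (d a c) (d a b) ∧ d a b = d b c) x₁ x₂ x₃

/-- `d : X² → Q` is a `≼`-ultrametric. -/
def QUltra {X Q : Type*} (le : Q → Q → Prop) (q₀ : Q) (d : X → X → Q) : Prop :=
  QPseudoUltra le q₀ d ∧ ∀ x y, d x y = q₀ ↔ x = y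

/-- The binary relation `u_Φ` on the range of `Φ`. -/
def uRel {X A : Type*} (Φ : X → X → A) : A → A → Prop :=
  fun y₁ y₂ => ∃ x₁ x₂ x₃, y₁ = Φ x₁ x₃ ∧ y₂ = Φ x₁ x₂ ∧ Φ x₁ x₂ = Φ x₂ x₃

/-- The binary relation `≼_Φ := u_Φᵗ ∪ Δ_{Φ(X²)}`. -/
def lePhi {X A : Type*} (Φ : X → X → A) : A → A → Prop :=
  fun a b => Relation.TransGen (uRel Φ) a b ∨ (a = b ∧ a ∈ rng Φ)

/-- `r` is a partial order on the subset `S`. -/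
def IsPartialOrderOn {A : Type*} (S : Set A) (r : A → A → Prop) : Prop :=
  (∀ a ∈ S, r a a) ∧
  (∀ a b c, a ∈ S → b ∈ S → c ∈ S → r a b → r b c → r a c) ∧
  (∀ a b, a ∈ S → b ∈ S → r a b → r b a → a = b)

/-- `r` is a linear (total) order on the subset `S`. -/
def IsLinearOrderOn {A : Type*} (S : Set A) (r : A → A → Prop) : Prop :=
  IsPartialOrderOn S r ∧ ∀ a b, a ∈ S → b ∈ S → (r a b ∨ r b a)

/-- A (real-valued, nonnegative) pseudometric. -/
def IsPseudoMetric {X : Type*} (d : X → X → ℝ) : Prop :=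
  (∀ x y, 0 ≤ d x y) ∧ (∀ x y, d x y = d y x) ∧ (∀ x, d x x = 0) ∧
  ∀ x y z, d x y ≤ d x z + d z y

/-- A (real-valued) metric. -/
def IsMetric {X : Type*} (d : X → X → ℝ) : Prop :=
  IsPseudoMetric d ∧ ∀ x y, d x y = 0 ↔ x = y

/-- A (real-valued, nonnegative) pseudoultrametric. -/
def IsPseudoUltrametric {X : Type*} (d : X → X → ℝ) : Prop :=
  (∀ x y, 0 ≤ d x y) ∧ (∀ x y, d x y = d y x) ∧ (∀ x, d x x = 0) ∧
  ∀ x y z, d x y ≤ max (d x z) (d z y)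

/-- A (real-valued) ultrametric. -/
def IsUltrametric {X : Type*} (d : X → X → ℝ) : Prop :=
  IsPseudoUltrametric d ∧ ∀ x y, d x y = 0 ↔ x = y

/-- `d` is a `le`-pseudoultrametric, where `le` is a partial order on `Q` having a smallest
element. -/
def IsPseudoUltraFor {X Q : Type*} (d : X → X → Q) (le : Q → Q → Prop) : Prop :=
  IsPartialOrder Q le ∧ ∃ q₀, (∀ q, le q₀ q) ∧ QPseudoUltra le q₀ d

/-- `g : X₁ → X₂` is a weak similarity for the `Q₁`-pseudoultrametric `d₁` and the
`Q₂`-pseudoultrametric `d₂`: `g` is a bijection and there is an order isomorphism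
`f` of the subposet `d₂(X₂²)` of `Q₂` onto the subposet `d₁(X₁²)` of `Q₁` with
`d₁(x, y) = f (d₂ (g x) (g y))`. -/
def WeakSim {X₁ X₂ Q₁ Q₂ : Type*} (le₁ : Q₁ → Q₁ → Prop) (le₂ : Q₂ → Q₂ → Prop)
    (d₁ : X₁ → X₁ → Q₁) (d₂ : X₂ → X₂ → Q₂) (g : X₁ → X₂) : Prop :=
  Function.Bijective g ∧ ∃ f : Q₂ → Q₁,
    Set.BijOn f (rng d₂) (rng d₁) ∧
    (∀ a ∈ rng d₂, ∀ b ∈ rng d₂, (le₂ a b ↔ le₁ (f a) (f b))) ∧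
    ∀ x y, d₁ x y = f (d₂ (g x) (g y))

/-- The subset `S`, ordered by `r`, is order-isomorphic to a subposet of `(ℝ⁺, ≤)`. -/
def EmbedsInRPlus {A : Type*} (S : Set A) (r : A → A → Prop) : Prop :=
  ∃ e : A → ℝ, (∀ a ∈ S, 0 ≤ e a) ∧ Set.InjOn e S ∧
    ∀ a ∈ S, ∀ b ∈ S, (r a b ↔ e a ≤ e b)

universe u v

theorem permTriple_iff {X : Type*} (P : X → X → X → Prop) (x y z : X) :
    PermTriple P x y z ↔ P x y z ∨ P x z y ∨ P y x z ∨ P y z x ∨ P z x y ∨ P z y x := by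
  constructor
  · rintro ⟨σ, h⟩
    have h01 : σ 0 ≠ σ 1 := fun h => by simpa using σ.injective h
    have h02 : σ 0 ≠ σ 2 := fun h => by simpa using σ.injective h
    have h12 : σ 1 ≠ σ 2 := fun h => by simpa using σ.injective h
    generalize σ 0 = i at *
    generalize σ 1 = j at *
    generalize σ 2 = k at *
    fin_cases i <;> fin_cases j <;> fin_cases k <;> simp_all
  · rintro (h | h | h | h | h | h)
    · exact ⟨1, h⟩
    · exact ⟨Equiv.swap 1 2, h⟩
    · exact ⟨Equiv.swap 0 1, h⟩
    · exact ⟨finRotate 3, h⟩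
    · exact ⟨(finRotate 3).symm, h⟩
    · exact ⟨Equiv.swap 0 2, h⟩

theorem PermTriple.imp {X : Type*} {P Q : X → X → X → Prop} (hPQ : ∀ a b c, P a b c → Q a b c)
    {x y z : X} : PermTriple P x y z → PermTriple Q x y z :=
  fun ⟨σ, h⟩ => ⟨σ, hPQ _ _ _ h⟩

theorem IsUltrametric.permTriple {X : Type*} {d : X → X → ℝ} (hd : IsUltrametric d)
    (x y z : X) : PermTriple (fun a b c => d a b = d b c) x y z := by
  obtain ⟨⟨-, hs, -, ht⟩, -⟩ := hd
  have h₁ := ht x y z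
  have h₂ := ht y z x
  have h₃ := ht x z y
  simp only [permTriple_iff, hs y x, hs z x, hs z y, le_max_iff] at h₁ h₂ h₃ ⊢
  clear hs ht
  generalize d x y = p, d x z = q, d y z = r at *
  by_contra! h
  rcases h₁ with h₁ | h₁ <;> rcases h₂ with h₂ | h₂ <;> rcases h₃ with h₃ | h₃ <;> grind

theorem mem_rng {X A : Type*} (Φ : X → X → A) (x y : X) : Φ x y ∈ rng Φ := ⟨x, y, rfl⟩

/-- `Φ` becomes an ultrametric after an injective relabelling of its values. -/
def HasUltrametricRelabelling {X A : Type*} (Φ : X → X → A) : Prop :=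
  ∃ e : A → ℝ, Set.InjOn e (rng Φ) ∧ IsUltrametric fun x y => e (Φ x y)

theorem exists_combSim_iff {X : Type u} {A : Type v} [Nonempty X] (Φ : X → X → A) :
    (∃ (Y : Type u) (_ : Nonempty Y) (ρ : Y → Y → ℝ), IsUltrametric ρ ∧ CombSim Φ ρ) ↔
      HasUltrametricRelabelling Φ := by
  constructor
  · rintro ⟨Y, -, ρ, ⟨⟨h0, hs, hr, ht⟩, hz⟩, g, hg, e, he, heq⟩
    have key : ∀ x y, e (Φ (g x) (g y)) = ρ x y := fun x y => (heq x y).symm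
    refine ⟨e, he.injOn, ⟨?_, ?_, ?_, ?_⟩, ?_⟩ <;>
      simp only [hg.surjective.forall, key, hg.injective.eq_iff] <;> assumption
  · rintro ⟨e, he, hu⟩
    refine ⟨X, inferInstance, _, hu, id, Function.bijective_id, e, ⟨?_, he, ?_⟩, fun _ _ => rfl⟩
    · rintro _ ⟨x, y, rfl⟩
      exact ⟨x, y, rfl⟩
    · rintro _ ⟨x, y, rfl⟩
      exact ⟨_, mem_rng Φ x y, rfl⟩

theorem le_of_uRel {X A : Type*} {Φ : X → X → A} {e : A → ℝ}
    (hu : IsUltrametric fun x y => e (Φ x y)) {a b : A} (h : uRel Φ a b) : e a ≤ e b := by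
  obtain ⟨x, y, z, rfl, rfl, hxy⟩ := h
  have := hu.1.2.2.2 x z y
  simpa [← hxy] using this

theorem le_of_lePhi {X A : Type*} {Φ : X → X → A} {e : A → ℝ}
    (hu : IsUltrametric fun x y => e (Φ x y)) {a b : A} (h : lePhi Φ a b) : e a ≤ e b := by
  rcases h with h | ⟨rfl, -⟩
  · induction h with
    | single h => exact le_of_uRel hu h
    | tail _ h ih => exact ih.trans (le_of_uRel hu h)
  · exact le_rfl

theorem lePhi_of_uRel {X A : Type*} {Φ : X → X → A} {a b : A} (h : uRel Φ a b) : lePhi Φ a b :=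
  Or.inl (.single h)

theorem lePhi_trans {X A : Type*} {Φ : X → X → A} {a b c : A} (hab : lePhi Φ a b)
    (hbc : lePhi Φ b c) : lePhi Φ a c := by
  rcases hab with hab | ⟨rfl, -⟩
  · rcases hbc with hbc | ⟨rfl, -⟩
    · exact Or.inl (hab.trans hbc)
    · exact Or.inl hab
  · exact hbc

theorem isLinearOrderOn_of_injOn {A : Type*} {S : Set A} {e : A → ℝ} (he : Set.InjOn e S) :
    IsLinearOrderOn S fun a b => e a ≤ e b :=
  ⟨⟨fun _ _ => le_rfl, fun _ _ _ _ _ _ => le_trans,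
    fun _ _ ha hb hab hba => he ha hb (le_antisymm hab hba)⟩, fun _ _ _ _ => le_total _ _⟩

/-- If the values of `Φ` are ordered compatibly with `uRel Φ` by a real-valued function `e` that is
least on the diagonal, then shifting `e` turns `Φ` into an ultrametric. -/
theorem isUltrametric_sub {X A : Type*} {Φ : X → X → A} {e : A → ℝ} {a₀ : A}
    (he : Set.InjOn e (rng Φ)) (hs : ∀ x y, Φ x y = Φ y x) (ha₀ : a₀ ∈ rng Φ)
    (hdiag : ∀ x y, Φ x y = a₀ ↔ x = y) (hmin : ∀ b ∈ rng Φ, e a₀ ≤ e b)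
    (hu : ∀ a b, uRel Φ a b → e a ≤ e b)
    (hperm : ∀ x₁ x₂ x₃ : X, PermTriple (fun a b c => Φ a b = Φ b c) x₁ x₂ x₃) :
    IsUltrametric fun x y => e (Φ x y) - e a₀ := by
  refine ⟨⟨fun x y => sub_nonneg.2 (hmin _ (mem_rng Φ x y)), fun x y => by simp only [hs x y],
    fun x => by simp only [(hdiag x x).2 rfl, sub_self], fun x y z => ?_⟩, fun x y => ?_⟩
  · have key : PermTriple
        (fun a b c => e (Φ a c) ≤ e (Φ a b) ∧ e (Φ a b) = e (Φ b c)) x y z :=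
      (hperm x y z).imp fun a b c h => ⟨hu _ _ ⟨a, b, c, rfl, rfl, h⟩, congrArg e h⟩
    simp only [permTriple_iff, hs y x, hs z x, hs z y] at key ⊢
    grind
  · rw [sub_eq_zero, he.eq_iff (mem_rng Φ x y) ha₀, hdiag]

/-- Corollary 4.22: for a mapping `Φ` with domain `X²`, the following are equivalent:
(i) `Φ` is combinatorially similar to an ultrametric; (ii) `Φ⁻¹(b₀) = Δ_X` for some `b₀` in
the range, `≼_Φ := u_Φᵗ ∪ Δ_{Φ(X²)}` is a partial order on `Φ(X²)` with smallest element
`b₀`, `Φ` is a `≼_Φ`-ultrametric, and there is a linear order `≼` on `Φ(X²)` containing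
`≼_Φ` such that `(Φ(X²), ≼)` is order-isomorphic to a subposet of `(ℝ⁺, ≤)`; (iii) `Φ` is
symmetric, `Φ⁻¹(a₀) = Δ_X` for some `a₀` in its range, every triple admits an isosceles
permutation, and there is a linear order `≼` on `Φ(X²)` with smallest element `a₀`,
containing `u_Φ`, such that `(Φ(X²), ≼)` is order-isomorphic to a subposet of
`(ℝ⁺, ≤)`. -/
theorem statement19 {X : Type u} {A : Type v} [Nonempty X] (Φ : X → X → A) :
    List.TFAE [
      ∃ (Y : Type u) (_ : Nonempty Y) (ρ : Y → Y → ℝ), IsUltrametric ρ ∧ CombSim Φ ρ,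
      ∃ b₀ ∈ rng Φ, (∀ x y, Φ x y = b₀ ↔ x = y) ∧
        IsPartialOrderOn (rng Φ) (lePhi Φ) ∧
        (∀ b ∈ rng Φ, lePhi Φ b₀ b) ∧
        QUltra (lePhi Φ) b₀ Φ ∧
        ∃ r : A → A → Prop, IsLinearOrderOn (rng Φ) r ∧
          (∀ a b, lePhi Φ a b → r a b) ∧ EmbedsInRPlus (rng Φ) r,
      (∀ x y, Φ x y = Φ y x) ∧
        (∃ a₀ ∈ rng Φ, (∀ x y, Φ x y = a₀ ↔ x = y) ∧
          ∃ r : A → A → Prop, IsLinearOrderOn (rng Φ) r ∧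
            (∀ b ∈ rng Φ, r a₀ b) ∧
            (∀ a b, uRel Φ a b → r a b) ∧ EmbedsInRPlus (rng Φ) r) ∧
        ∀ x₁ x₂ x₃ : X, PermTriple (fun a b c => Φ a b = Φ b c) x₁ x₂ x₃ ] := by
  rw [exists_combSim_iff]
  tfae_have 1 → 2 := by
    rintro ⟨e, he, hu⟩
    have hinj : ∀ {x y z w}, e (Φ x y) = e (Φ z w) → Φ x y = Φ z w :=
      fun h => he (mem_rng Φ _ _) (mem_rng Φ _ _) h
    obtain ⟨o⟩ := ‹Nonempty X›
    have hs : ∀ x y, Φ x y = Φ y x := fun x y => hinj (hu.1.2.1 x y)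
    have hoo : e (Φ o o) = 0 := hu.1.2.2.1 o
    have hdiag : ∀ x y, Φ x y = Φ o o ↔ x = y := fun x y => by
      rw [← hu.2 x y, ← hoo, he.eq_iff (mem_rng Φ x y) (mem_rng Φ o o)]
    refine ⟨Φ o o, mem_rng Φ o o, hdiag, ⟨fun a ha => Or.inr ⟨rfl, ha⟩,
      fun _ _ _ _ _ _ => lePhi_trans, fun a b ha hb hab hba =>
        he ha hb (le_antisymm (le_of_lePhi hu hab) (le_of_lePhi hu hba))⟩, ?_,
      ⟨⟨hs, fun x => (hdiag x x).2 rfl, fun x y z => ?_⟩, hdiag⟩,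
      fun a b => e a ≤ e b, isLinearOrderOn_of_injOn he, fun _ _ => le_of_lePhi hu,
      e, ?_, he, fun _ _ _ _ => Iff.rfl⟩
    · rintro _ ⟨x, y, rfl⟩
      exact lePhi_of_uRel ⟨x, y, x, ((hdiag x x).2 rfl).symm, rfl, hs x y⟩
    · exact (hu.permTriple x y z).imp fun a b c h =>
        ⟨lePhi_of_uRel ⟨a, b, c, rfl, rfl, hinj h⟩, hinj h⟩
    · rintro _ ⟨x, y, rfl⟩
      exact hu.1.1 x y
  tfae_have 2 → 3 := by
    rintro ⟨b₀, hb₀, hdiag, -, hmin, ⟨⟨hs, -, hperm⟩, -⟩, r, hr, hsub, hemb⟩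
    exact ⟨hs, ⟨b₀, hb₀, hdiag, r, hr, fun b hb => hsub _ _ (hmin b hb),
      fun a b h => hsub _ _ (lePhi_of_uRel h), hemb⟩,
      fun x y z => (hperm x y z).imp fun _ _ _ h => h.2⟩
  tfae_have 3 → 1 := by
    rintro ⟨hs, ⟨a₀, ha₀, hdiag, r, -, hmin, hu, e, -, he, hre⟩, hperm⟩
    refine ⟨fun a => e a - e a₀, fun a ha b hb h => he ha hb (sub_left_injective h),
      isUltrametric_sub he hs ha₀ hdiag (fun b hb => (hre _ ha₀ _ hb).1 (hmin b hb)) ?_ hperm⟩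
    rintro _ _ ⟨x, y, z, rfl, rfl, h⟩
    exact (hre _ (mem_rng Φ x z) _ (mem_rng Φ x y)).1 (hu _ _ ⟨x, y, z, rfl, rfl, h⟩)
  tfae_finish

end CombSimPaper
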